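/- Supplement to the Assmus–Mattson theorem for additive codes over translation association schemes: Let X be a finite abelian group carrying a translation association scheme with s ≥ 1 classes given by a partition X = X₀ ⊔ X₁ ⊔ … ⊔ X_s with X₀ = {0}, let n ≥ 2, base vertex 0, and let C be a subgroup of X^n with 1 < |C| < |X|^n. Fix the dual class partition X* = X₀* ⊔ … ⊔ X_s* of the character group as described. Let 1 ≤ t ≤ n and suppose given a set L ⊆ ℕ^s such that for every α ∈ L with |α| ≤ n, the set (X*^n)_α ∩ C^⊥ is a weakly t-balanced array over the dual scheme. Suppose the set {|α| : α ∈ ℕ^s, α ≠ 0, α ∉ L, |α| ≤ n, (X*^n)_α ∩ C^⊥ ≠ ∅} is nonempty, and let δ_L* be its minimum. For 1 ≤ r ≤ n let S_r = {α ∈ ℕ^s : r ≤ |α| ≤ n−r and (X^n)_α ∩ C ≠ ∅}. If μ(S_r) < δ_L* − r for all 1 ≤ r ≤ t, then for every α ∈ ℕ^s with |α| ≤ n, the multiset {supp(x) : x ∈ (X^n)_α ∩ C} is a t-design with blocks of size |α|. -/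

import Mathlib

open Finset
open scoped Classical

noncomputable section

/-- The 0-1 adjacency matrix of a relation on `X`. -/
def adjMat {X : Type} [Fintype X] [DecidableEq X] (R : Set (X × X)) : Matrix X X ℂ :=
  fun x y => if (x, y) ∈ R then 1 else 0

/-- A commutative association scheme with `s` classes on a finite set `X`. -/
structure CommAssocScheme (X : Type) [Fintype X] [DecidableEq X] (s : ℕ) where
  R : Fin (s + 1) → Set (X × X)
  rel_nonempty : ∀ i, (R i).Nonempty
  rel_disjoint : ∀ i j, i ≠ j → R i ∩ R j = ∅
  rel_cover : ∀ p : X × X, ∃ i, p ∈ R i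
  rel_diag : R 0 = {p : X × X | p.1 = p.2}
  transpose_closed : ∀ i, ∃ j, {p : X × X | (p.2, p.1) ∈ R i} = R j
  adj_comm : ∀ i j, adjMat (R i) * adjMat (R j) = adjMat (R j) * adjMat (R i)
  adj_span : ∀ i j, adjMat (R i) * adjMat (R j) ∈
    Submodule.span ℂ (Set.range fun k => adjMat (R k))

/-- The composition `c(x,y) ∈ ℕ^s` of two words `x, y ∈ X^n`. -/
def comp {X : Type} [Fintype X] [DecidableEq X] {s : ℕ} (A : CommAssocScheme X s)
    {n : ℕ} (x y : Fin n → X) : Fin s → ℕ :=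
  fun i => (univ.filter fun ℓ => (x ℓ, y ℓ) ∈ A.R i.succ).card

/-- The Krawtchouk number `K_i(j)` for the Hamming scheme `H(n,q)`. -/
def kraw (q n i j : ℕ) : ℝ :=
  ∑ h ∈ Finset.range (i + 1),
    (-1 : ℝ) ^ h * ((q : ℝ) - 1) ^ (i - h) * (j.choose h : ℝ) * ((n - j).choose (i - h) : ℝ)

/-- `L` is an interpolation space with respect to `S ⊆ ℝ^s`. -/
def IsInterpSpace {s : ℕ} (S : Set (Fin s → ℝ)) (L : Submodule ℝ (MvPolynomial (Fin s) ℝ)) :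
    Prop :=
  ∀ f : MvPolynomial (Fin s) ℝ, ∃! g : MvPolynomial (Fin s) ℝ,
    g ∈ L ∧ ∀ z ∈ S, MvPolynomial.eval z g = MvPolynomial.eval z f

/-- `L` is a minimal degree interpolation space with respect to `S ⊆ ℝ^s`. -/
def IsMinDegInterpSpace {s : ℕ} (S : Set (Fin s → ℝ))
    (L : Submodule ℝ (MvPolynomial (Fin s) ℝ)) : Prop :=
  IsInterpSpace S L ∧
    ∀ f g : MvPolynomial (Fin s) ℝ, g ∈ L →
      (∀ z ∈ S, MvPolynomial.eval z g = MvPolynomial.eval z f) →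
      g.totalDegree ≤ f.totalDegree

/-- The maximal total degree occurring in a space of polynomials. -/
def degSup {s : ℕ} (L : Submodule ℝ (MvPolynomial (Fin s) ℝ)) : ℕ :=
  sSup (MvPolynomial.totalDegree '' (L : Set (MvPolynomial (Fin s) ℝ)))

/-- `μ(S)`: the maximal degree of a minimal degree interpolation space with respect to `S`. -/
def mu {s : ℕ} (S : Set (Fin s → ℝ)) : ℕ :=
  sSup (degSup '' {L | IsMinDegInterpSpace S L})

/-- A subspace mapped injectively by `ev` which, below level `d`, realizes all values of `ev`
within each step of the filtration `F`. -/
theorem exists_filtered_complement {V U : Type*} [AddCommGroup V] [Module ℝ V]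
    [AddCommGroup U] [Module ℝ U] (ev : V →ₗ[ℝ] U) (F : ℕ → Submodule ℝ V) (hF : Monotone F)
    (d : ℕ) :
    ∃ M ≤ F d, (∀ m ∈ M, ev m = 0 → m = 0) ∧
      ∀ e < d, ∀ f ∈ F e, ∃ g ∈ M, g ∈ F e ∧ ev g = ev f := by
  induction d with
  | zero => exact ⟨⊥, bot_le, by simp, by simp⟩
  | succ d ih =>
    obtain ⟨M, hM, hinj, hsurj⟩ := ih
    set K := M ⊔ (LinearMap.ker ev ⊓ F d) with hK
    have hKF : K ≤ F d := sup_le hM inf_le_right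
    obtain ⟨Q, hQ⟩ := exists_isCompl K
    have hW : K ⊔ Q ⊓ F d = F d := by
      rw [← sup_inf_assoc_of_le Q hKF, hQ.sup_eq_top, top_inf_eq]
    refine ⟨M ⊔ Q ⊓ F d, (sup_le hM inf_le_right).trans (hF d.le_succ), ?_, ?_⟩
    · intro m hm h0
      obtain ⟨a, ha, w, hw, rfl⟩ := Submodule.mem_sup.1 hm
      have hk : a + w ∈ K := Submodule.mem_sup_right
        ⟨h0, (F d).add_mem (hM ha) hw.2⟩
      have hwK : w ∈ K := by
        simpa using K.sub_mem hk (Submodule.mem_sup_left ha)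
      have hw0 : w = 0 := Submodule.disjoint_def.1 hQ.disjoint w hwK hw.1
      subst hw0
      rw [add_zero] at h0 ⊢
      exact hinj a ha h0
    · intro e he f hf
      rcases Nat.lt_succ_iff_lt_or_eq.1 he with he | rfl
      · obtain ⟨g, hg, h⟩ := hsurj e he f hf
        exact ⟨g, Submodule.mem_sup_left hg, h⟩
      · rw [← hW] at hf
        obtain ⟨k, hk, w, hw, rfl⟩ := Submodule.mem_sup.1 hf
        obtain ⟨a, ha, b, hb, rfl⟩ := Submodule.mem_sup.1 hk
        refine ⟨a + w, Submodule.add_mem_sup ha hw, (F e).add_mem (hM ha) hw.2, ?_⟩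
        have : ev b = 0 := hb.1
        simp [this]

/-- A polynomial vanishing on all points of a finite set but one. -/
theorem exists_eval_eq_ite {s : ℕ} (S : Finset (Fin s → ℝ)) (z : Fin s → ℝ) :
    ∃ p : MvPolynomial (Fin s) ℝ, ∀ w ∈ S, MvPolynomial.eval w p = if w = z then 1 else 0 := by
  set q : MvPolynomial (Fin s) ℝ :=
    ∏ w ∈ S.erase z, ∑ i, (MvPolynomial.X i - MvPolynomial.C (w i)) ^ 2 with hq
  have hqe : ∀ v, MvPolynomial.eval v q = ∏ w ∈ S.erase z, ∑ i, (v i - w i) ^ 2 := by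
    intro v
    simp [hq, map_prod]
  have hz : MvPolynomial.eval z q ≠ 0 := by
    rw [hqe, Finset.prod_ne_zero_iff]
    intro w hw h0
    refine (Finset.mem_erase.1 hw).1 (funext fun i => ?_)
    rw [Finset.sum_eq_zero_iff_of_nonneg fun i _ => sq_nonneg _] at h0
    have := h0 i (mem_univ i)
    rw [sq_eq_zero_iff, sub_eq_zero] at this
    exact this.symm
  refine ⟨MvPolynomial.C (MvPolynomial.eval z q)⁻¹ * q, fun w hw => ?_⟩
  split_ifs with h
  · subst h; simp [hz]
  · have : MvPolynomial.eval w q = 0 := by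
      rw [hqe]
      exact Finset.prod_eq_zero (Finset.mem_erase.2 ⟨h, hw⟩) (by simp)
    simp [this]

theorem exists_interp_degree_bound {s : ℕ} {S : Set (Fin s → ℝ)} (hS : S.Finite) :
    ∃ D : ℕ, ∀ f : MvPolynomial (Fin s) ℝ, ∃ g : MvPolynomial (Fin s) ℝ,
      g.totalDegree ≤ D ∧ ∀ z ∈ S, MvPolynomial.eval z g = MvPolynomial.eval z f := by
  choose p hp using exists_eval_eq_ite hS.toFinset
  refine ⟨hS.toFinset.sup fun z => (p z).totalDegree, fun f =>
    ⟨∑ z ∈ hS.toFinset, MvPolynomial.eval z f • p z, ?_, ?_⟩⟩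
  · rw [← MvPolynomial.mem_restrictTotalDegree]
    refine Submodule.sum_mem _ fun z hz => Submodule.smul_mem _ _ ?_
    rw [MvPolynomial.mem_restrictTotalDegree]
    exact Finset.le_sup (f := fun z => (p z).totalDegree) hz
  · intro w hw
    have hw' : w ∈ hS.toFinset := hS.mem_toFinset.2 hw
    simp only [map_sum, MvPolynomial.smul_eval, hp _ _ hw', mul_ite, mul_one, mul_zero]
    rw [Finset.sum_ite_eq, if_pos hw']

/-- Every polynomial agrees on a finite set `S` with one of degree at most `μ(S)`. -/
theorem exists_totalDegree_le_mu {s : ℕ} {S : Set (Fin s → ℝ)} (hS : S.Finite)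
    (f : MvPolynomial (Fin s) ℝ) : ∃ g : MvPolynomial (Fin s) ℝ,
      g.totalDegree ≤ mu S ∧ ∀ z ∈ S, MvPolynomial.eval z g = MvPolynomial.eval z f := by
  obtain ⟨D, hD⟩ := exists_interp_degree_bound hS
  have hbd : ∀ M, IsMinDegInterpSpace S M → ∀ g ∈ M, g.totalDegree ≤ D := by
    intro M hM g hg
    obtain ⟨f, hf, he⟩ := hD g
    exact (hM.2 f g hg fun z hz => (he z hz).symm).trans hf
  let ev : MvPolynomial (Fin s) ℝ →ₗ[ℝ] (S → ℝ) :=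
    LinearMap.pi fun z => (MvPolynomial.aeval (z : Fin s → ℝ)).toLinearMap
  have hev : ∀ a b, ev a = ev b ↔ ∀ z ∈ S, MvPolynomial.eval z a = MvPolynomial.eval z b := by
    intro a b
    simp [ev, funext_iff, MvPolynomial.aeval_eq_eval]
  obtain ⟨M, -, hinj, hsurj⟩ := exists_filtered_complement ev
    (fun d => MvPolynomial.restrictTotalDegree (Fin s) ℝ d)
    (fun a b hab f hf => by
      rw [MvPolynomial.mem_restrictTotalDegree] at hf ⊢
      exact hf.trans hab) (D + 1)
  have huniq : ∀ a ∈ M, ∀ b ∈ M, ev a = ev b → a = b := fun a ha b hb h =>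
    sub_eq_zero.1 (hinj _ (M.sub_mem ha hb) (by rw [map_sub, h, sub_self]))
  have hdeg : ∀ f : MvPolynomial (Fin s) ℝ, ∃ g ∈ M,
      g.totalDegree ≤ f.totalDegree ∧ ev g = ev f := by
    intro f
    rcases le_or_gt f.totalDegree D with h | h
    · obtain ⟨g, hg, hgd, he⟩ := hsurj f.totalDegree (Nat.lt_succ_of_le h) f
        ((MvPolynomial.mem_restrictTotalDegree _ _ _).2 le_rfl)
      exact ⟨g, hg, (MvPolynomial.mem_restrictTotalDegree _ _ _).1 hgd, he⟩
    · obtain ⟨f', hf', he'⟩ := hD f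
      obtain ⟨g, hg, hgd, he⟩ := hsurj D D.lt_succ_self f'
        ((MvPolynomial.mem_restrictTotalDegree _ _ _).2 hf')
      exact ⟨g, hg, ((MvPolynomial.mem_restrictTotalDegree _ _ _).1 hgd).trans h.le,
        he.trans ((hev _ _).2 he')⟩
  have hM : IsMinDegInterpSpace S M := by
    refine ⟨fun f => ?_, fun f g hg h => ?_⟩
    · obtain ⟨g, hg, -, he⟩ := hdeg f
      exact ⟨g, ⟨hg, (hev _ _).1 he⟩, fun g' hg' =>
        huniq g' hg'.1 g hg (((hev _ _).2 hg'.2).trans he.symm)⟩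
    · obtain ⟨g', hg', hd, he⟩ := hdeg f
      rwa [huniq g hg g' hg' (((hev _ _).2 h).trans he.symm)]
  obtain ⟨g, hg, -, he⟩ := hdeg f
  refine ⟨g, ?_, (hev _ _).1 he⟩
  refine (le_csSup (s := MvPolynomial.totalDegree '' (M : Set (MvPolynomial (Fin s) ℝ)))
    ⟨D, ?_⟩ ⟨g, hg, rfl⟩).trans (le_csSup (s := degSup '' {L | IsMinDegInterpSpace S L}) (a := degSup M)
      ⟨D, ?_⟩ ⟨M, hM, rfl⟩)
  · rintro _ ⟨g, hg, rfl⟩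
    exact hbd M hM g hg
  · rintro _ ⟨M', hM', rfl⟩
    refine csSup_le ⟨_, 0, M'.zero_mem, rfl⟩ ?_
    rintro _ ⟨g, hg, rfl⟩
    exact hbd M' hM' g hg

section Characters

variable {X : Type} [AddCommGroup X] {n : ℕ}

/-- The character of `X^n` given by a tuple of characters of `X`. -/
def charProd (ε : Fin n → AddChar X ℂ) (x : Fin n → X) : ℂ := ∏ ℓ, ε ℓ (x ℓ)

theorem charProd_add (ε : Fin n → AddChar X ℂ) (x y : Fin n → X) :
    charProd ε (x + y) = charProd ε x * charProd ε y := by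
  simp [charProd, AddChar.map_add_eq_mul, Finset.prod_mul_distrib]

variable [Fintype X]

theorem sum_charProd_apply (x : Fin n → X) :
    ∑ ε : Fin n → AddChar X ℂ, charProd ε x = if x = 0 then (Fintype.card X : ℂ) ^ n else 0 := by
  have h := Finset.prod_univ_sum (fun _ : Fin n => (univ : Finset (AddChar X ℂ)))
    (fun ℓ ε => ε (x ℓ))
  rw [Fintype.piFinset_univ] at h
  rw [show (∑ ε : Fin n → AddChar X ℂ, charProd ε x) = _ from h.symm]
  simp only [AddChar.sum_apply_eq_ite]
  split_ifs with hx
  · simp [hx]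
  · obtain ⟨ℓ, hℓ⟩ := Function.ne_iff.1 hx
    exact Finset.prod_eq_zero (mem_univ ℓ) (if_neg hℓ)

theorem sum_code_charProd (C : AddSubgroup (Fin n → X)) (ε : Fin n → AddChar X ℂ) :
    ∑ y with y ∈ C, charProd ε y =
      if ∀ y ∈ C, charProd ε y = 1 then (Nat.card C : ℂ) else 0 := by
  split_ifs with h
  · rw [Finset.sum_congr rfl fun y hy => h y (Finset.mem_filter.1 hy).2]
    rw [Finset.sum_const, nsmul_one, Nat.card_eq_fintype_card,
      Fintype.card_of_subtype (univ.filter fun y => y ∈ C) fun y => by simp]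
  · push Not at h
    obtain ⟨a, ha, h1⟩ := h
    have : charProd ε a * ∑ y with y ∈ C, charProd ε y = ∑ y with y ∈ C, charProd ε y := by
      rw [Finset.mul_sum]
      refine Finset.sum_bij' (fun y _ => a + y) (fun y _ => -a + y) ?_ ?_ ?_ ?_ ?_
      · intro y hy
        simpa [C.add_mem_cancel_left ha] using hy
      · intro y hy
        simpa [C.add_mem_cancel_left (C.neg_mem ha)] using hy
      · simp
      · simp
      · intro y _
        rw [charProd_add]
    by_contra h0
    exact h1 (mul_right_cancel₀ h0 (by rw [this, one_mul]))

/-- The Poisson summation formula for a subgroup of `X^n`. -/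
theorem poisson_summation (C : AddSubgroup (Fin n → X)) (G : (Fin n → X) → ℂ) :
    (Fintype.card X : ℂ) ^ n * ∑ x with x ∈ C, G x =
      (Nat.card C : ℂ) * ∑ ε : Fin n → AddChar X ℂ with ∀ y ∈ C, charProd ε y = 1,
        ∑ x, G x * charProd ε x := by
  have hx : ∀ x : Fin n → X, (if x ∈ C then (Fintype.card X : ℂ) ^ n else 0) =
      ∑ ε : Fin n → AddChar X ℂ with ∀ y ∈ C, charProd ε y = 1,
        (Nat.card C : ℂ) * charProd ε x := by
    intro x
    calc (if x ∈ C then (Fintype.card X : ℂ) ^ n else 0)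
        = ∑ y with y ∈ C, ∑ ε : Fin n → AddChar X ℂ, charProd ε (y + x) := by
          simp only [sum_charProd_apply, add_eq_zero_iff_eq_neg]
          rw [Finset.sum_ite_eq']
          simp
      _ = ∑ ε : Fin n → AddChar X ℂ,
            (if ∀ y ∈ C, charProd ε y = 1 then (Nat.card C : ℂ) else 0) * charProd ε x := by
          rw [Finset.sum_comm]
          refine Finset.sum_congr rfl fun ε _ => ?_
          rw [← sum_code_charProd, Finset.sum_mul]
          exact Finset.sum_congr rfl fun y _ => charProd_add ε y x
      _ = _ := by
          rw [Finset.sum_filter]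
          exact Finset.sum_congr rfl fun ε _ => by split_ifs <;> simp
  calc (Fintype.card X : ℂ) ^ n * ∑ x with x ∈ C, G x
      = ∑ x, G x * (if x ∈ C then (Fintype.card X : ℂ) ^ n else 0) := by
        rw [Finset.sum_filter, Finset.mul_sum]
        exact Finset.sum_congr rfl fun x _ => by split_ifs <;> ring
    _ = _ := by
        simp only [hx, Finset.mul_sum]
        rw [Finset.sum_comm]
        exact Finset.sum_congr rfl fun ε _ => Finset.sum_congr rfl fun x _ => by ring

/-- A function of few coordinates is orthogonal to characters of large weight. -/
theorem sum_mul_charProd_eq_zero_of_dependsOn {J : Finset (Fin n)} {g : (Fin n → X) → ℂ}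
    (hg : DependsOn g (J : Set (Fin n))) {ε : Fin n → AddChar X ℂ}
    (hJ : J.card < (univ.filter fun ℓ => ε ℓ ≠ 1).card) :
    ∑ x, g x * charProd ε x = 0 := by
  obtain ⟨ℓ, hℓ, hℓJ⟩ := Finset.exists_mem_notMem_of_card_lt_card hJ
  obtain ⟨a, ha⟩ := AddChar.ne_one_iff.1 (Finset.mem_filter.1 hℓ).2
  have hsingle : charProd ε (Pi.single ℓ a) = ε ℓ a := by
    rw [charProd, Finset.prod_eq_single ℓ]
    · simp
    · intro k _ hk
      simp [hk]
    · simp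
  have : (∑ x, g x * charProd ε x) * ε ℓ a = ∑ x, g x * charProd ε x := by
    rw [Finset.sum_mul, ← Equiv.sum_comp (Equiv.addRight (Pi.single ℓ a : Fin n → X))
      fun x => g x * charProd ε x]
    refine Finset.sum_congr rfl fun x _ => ?_
    rw [Equiv.coe_addRight, charProd_add, hsingle, mul_assoc]
    congr 1
    refine hg fun k hk => ?_
    have : k ≠ ℓ := fun h => hℓJ (h ▸ hk)
    simp [this]
  by_contra h0
  exact ha (mul_left_cancel₀ h0 (by rw [this, mul_one]))

/-- The class-count polynomial weight, restricted to words whose classes on `R` are nonzero. -/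
def classWeight {s : ℕ} (p : MvPolynomial (Fin s) ℝ) (R : Finset (Fin n))
    (c : Fin n → Fin (s + 1)) : ℂ :=
  if ∀ ℓ ∈ R, c ℓ ≠ 0 then
    ((MvPolynomial.eval (fun i => ((univ.filter fun ℓ => c ℓ = i.succ).card : ℝ)) p : ℝ) : ℂ)
  else 0

theorem sum_mul_prod_pow_card_mul_charProd_eq_zero {s : ℕ} (cls : X → Fin (s + 1))
    (ε : Fin n → AddChar X ℂ) (m : Fin s → ℕ) (I : Finset (Fin s)) :
    ∀ (J : Finset (Fin n)) (g : (Fin n → X) → ℂ), DependsOn g (J : Set (Fin n)) →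
      J.card + ∑ i ∈ I, m i < (univ.filter fun ℓ => ε ℓ ≠ 1).card →
      ∑ x, g x * (∏ i ∈ I, ((univ.filter fun ℓ => cls (x ℓ) = i.succ).card : ℂ) ^ m i) *
        charProd ε x = 0 := by
  have hstep : ∀ (k : ℕ) (h : (Fin n → X) → ℂ) (i : Fin s),
      (∀ (J : Finset (Fin n)) (g : (Fin n → X) → ℂ), DependsOn g (J : Set (Fin n)) →
        J.card + k < (univ.filter fun ℓ => ε ℓ ≠ 1).card →
        ∑ x, g x * h x * charProd ε x = 0) →
      ∀ (J : Finset (Fin n)) (g : (Fin n → X) → ℂ), DependsOn g (J : Set (Fin n)) →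
        J.card + (k + 1) < (univ.filter fun ℓ => ε ℓ ≠ 1).card →
        ∑ x, g x * (((univ.filter fun ℓ => cls (x ℓ) = i.succ).card : ℂ) * h x) *
          charProd ε x = 0 := by
    intro k h i hk J g hg hJ
    have : ∀ x, g x * (((univ.filter fun ℓ => cls (x ℓ) = i.succ).card : ℂ) * h x) *
          charProd ε x =
        ∑ ℓ, (g x * if cls (x ℓ) = i.succ then 1 else 0) * h x * charProd ε x := by
      intro x
      rw [Finset.natCast_card_filter, ← Finset.sum_mul, ← Finset.sum_mul, ← Finset.mul_sum]
      ring
    simp only [this]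
    rw [Finset.sum_comm]
    refine Finset.sum_eq_zero fun ℓ _ => ?_
    refine hk (insert ℓ J) (fun x => g x * if cls (x ℓ) = i.succ then 1 else 0) ?_ ?_
    · intro x y hxy
      have h1 : g x = g y := hg fun k hk => hxy k (by simp [Finset.mem_coe.1 hk])
      have h2 : x ℓ = y ℓ := hxy ℓ (by simp)
      simp only [h1, h2]
    · have := Finset.card_insert_le ℓ J
      omega
  induction I using Finset.induction_on with
  | empty =>
    intro J g hg hJ
    simpa using sum_mul_charProd_eq_zero_of_dependsOn hg (by simpa using hJ)
  | insert i I hi ih =>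
    rw [Finset.sum_insert hi]
    simp only [Finset.prod_insert hi]
    generalize m i = a
    induction a with
    | zero => simpa using ih
    | succ a iha =>
      intro J g hg hJ
      have := hstep _ _ i iha J g hg (by omega)
      simpa only [pow_succ', mul_assoc] using this

theorem sum_classWeight_mul_charProd_eq_zero {s : ℕ} (cls : X → Fin (s + 1))
    (p : MvPolynomial (Fin s) ℝ) (R : Finset (Fin n)) (ε : Fin n → AddChar X ℂ)
    (hε : p.totalDegree + R.card < (univ.filter fun ℓ => ε ℓ ≠ 1).card) :
    ∑ x : Fin n → X, classWeight p R (fun ℓ => cls (x ℓ)) * charProd ε x = 0 := by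
  set g : (Fin n → X) → ℂ := fun x => if ∀ ℓ ∈ R, cls (x ℓ) ≠ 0 then 1 else 0 with hgdef
  have hg : DependsOn g (R : Set (Fin n)) := by
    intro x y hxy
    have : (∀ ℓ ∈ R, cls (x ℓ) ≠ 0) ↔ ∀ ℓ ∈ R, cls (y ℓ) ≠ 0 :=
      forall₂_congr fun ℓ hℓ => by rw [hxy ℓ hℓ]
    simp only [hgdef, this]
  have hx : ∀ x : Fin n → X, classWeight p R (fun ℓ => cls (x ℓ)) * charProd ε x =
      ∑ m ∈ p.support, ((p.coeff m : ℝ) : ℂ) * (g x *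
        (∏ i, ((univ.filter fun ℓ => cls (x ℓ) = i.succ).card : ℂ) ^ m i) * charProd ε x) := by
    intro x
    rw [classWeight, MvPolynomial.eval_eq']
    simp only [hgdef]
    split_ifs
    · push_cast
      rw [Finset.sum_mul]
      exact Finset.sum_congr rfl fun m _ => by ring
    · simp
  simp only [hx]
  rw [Finset.sum_comm]
  refine Finset.sum_eq_zero fun m hm => ?_
  rw [← Finset.mul_sum, sum_mul_prod_pow_card_mul_charProd_eq_zero cls ε m univ R g hg, mul_zero]
  have := MvPolynomial.le_totalDegree hm
  rw [Finsupp.sum_fintype _ _ (by simp)] at this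
  omega

/-- The transform of a function of the classes depends on a character tuple only through its
class sums. -/
theorem sum_comp_mul_charProd_congr {κ : Type*} [Fintype κ] [DecidableEq κ] (cls : X → κ)
    (g : (Fin n → κ) → ℂ) (ε η : Fin n → AddChar X ℂ)
    (h : ∀ ℓ j, ∑ x with cls x = j, ε ℓ x = ∑ x with cls x = j, η ℓ x) :
    ∑ x : Fin n → X, g (fun ℓ => cls (x ℓ)) * charProd ε x =
      ∑ x : Fin n → X, g (fun ℓ => cls (x ℓ)) * charProd η x := by
  have key : ∀ θ : Fin n → AddChar X ℂ,
      ∑ x : Fin n → X, g (fun ℓ => cls (x ℓ)) * charProd θ x =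
        ∑ c : Fin n → κ, g c * ∏ ℓ, ∑ x with cls x = c ℓ, θ ℓ x := by
    intro θ
    rw [← Finset.sum_fiberwise_of_maps_to (s := univ) (t := univ)
      (g := fun (x : Fin n → X) ℓ => cls (x ℓ)) fun _ _ => mem_univ _]
    refine Finset.sum_congr rfl fun c _ => ?_
    rw [Finset.prod_univ_sum, Finset.mul_sum]
    refine Finset.sum_congr ?_ fun x hx => ?_
    · ext x
      simp [funext_iff]
    · have hc : (fun ℓ => cls (x ℓ)) = c := by
        simpa [funext_iff] using hx
      rw [hc, charProd]
  simp only [key, h]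

theorem classWeight_comp_perm {s : ℕ} (p : MvPolynomial (Fin s) ℝ) {R R' : Finset (Fin n)}
    (c : Fin n → Fin (s + 1)) (σ : Equiv.Perm (Fin n)) (hσ : ∀ ℓ, σ ℓ ∈ R' ↔ ℓ ∈ R) :
    classWeight p R (fun ℓ => c (σ ℓ)) = classWeight p R' c := by
  have h1 : (∀ ℓ ∈ R, c (σ ℓ) ≠ 0) ↔ ∀ ℓ ∈ R', c ℓ ≠ 0 := by
    rw [← σ.forall_congr_right (q := fun ℓ => ℓ ∈ R' → c ℓ ≠ 0)]
    simp only [hσ]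
  have h2 : ∀ j, (univ.filter fun ℓ => c (σ ℓ) = j).card = (univ.filter fun ℓ => c ℓ = j).card :=
    fun j => Finset.card_bijective σ σ.bijective (by simp)
  simp only [classWeight, h1, h2]

theorem exists_perm_of_card_fiber_eq {s : ℕ} (c c' : Fin n → Fin (s + 1))
    (R R' : Finset (Fin n)) (hR : R.card = R'.card)
    (h : ∀ i : Fin s, (univ.filter fun ℓ => c ℓ = i.succ).card =
      (univ.filter fun ℓ => c' ℓ = i.succ).card)
    (hr : ∀ i : Fin s, (R.filter fun ℓ => c ℓ = i.succ).card =
      (R'.filter fun ℓ => c' ℓ = i.succ).card) :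
    ∃ σ : Equiv.Perm (Fin n), (∀ ℓ, σ ℓ ∈ R' ↔ ℓ ∈ R) ∧ ∀ ℓ, c' (σ ℓ) = c ℓ := by
  have hzero : ∀ U U' : Finset (Fin n), U.card = U'.card →
      (∀ i : Fin s, (U.filter fun ℓ => c ℓ = i.succ).card =
        (U'.filter fun ℓ => c' ℓ = i.succ).card) →
      ∀ j, (U.filter fun ℓ => c ℓ = j).card = (U'.filter fun ℓ => c' ℓ = j).card := by
    intro U U' hU hUU' j
    have e1 := Finset.card_eq_sum_card_fiberwise (s := U) (t := univ) (f := c) (by simp)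
    have e2 := Finset.card_eq_sum_card_fiberwise (s := U') (t := univ) (f := c') (by simp)
    rw [Fin.sum_univ_succ] at e1 e2
    rw [Finset.sum_congr rfl fun i _ => hUU' i] at e1
    refine Fin.cases ?_ hUU' j
    omega
  have hfib : ∀ (b : Prop) (j : Fin (s + 1)),
      Nonempty ({ℓ // (ℓ ∈ R, c ℓ) = (b, j)} ≃ {ℓ // (ℓ ∈ R', c' ℓ) = (b, j)}) := by
    intro b j
    rw [← Fintype.card_eq, Fintype.card_subtype, Fintype.card_subtype]
    have hRj := hzero R R' hR hr j
    have hUj := hzero univ univ rfl h j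
    have split : ∀ (U : Finset (Fin n)) (d : Fin n → Fin (s + 1)),
        (U.filter fun ℓ => d ℓ = j).card +
          (univ.filter fun ℓ => ℓ ∉ U ∧ d ℓ = j).card = (univ.filter fun ℓ => d ℓ = j).card := by
      intro U d
      rw [← Finset.card_filter_add_card_filter_not (s := univ.filter fun ℓ => d ℓ = j)
        (fun ℓ => ℓ ∈ U)]
      congr 2 <;> ext ℓ <;> simp [and_comm]
    have s1 := split R c
    have s2 := split R' c'
    by_cases hb : b
    · simp only [Prod.mk.injEq, eq_iff_iff, hb, iff_true]
      simpa only [← Finset.filter_filter, Finset.filter_mem_eq_inter, Finset.univ_inter] using hRj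
    · simp only [Prod.mk.injEq, eq_iff_iff, hb, iff_false]
      omega
  refine ⟨Equiv.ofFiberEquiv (f := fun ℓ => (ℓ ∈ R, c ℓ)) (g := fun ℓ => (ℓ ∈ R', c' ℓ))
    fun x => (hfib x.1 x.2).some, ?_, ?_⟩
  · intro ℓ
    have := Equiv.ofFiberEquiv_map (f := fun ℓ => (ℓ ∈ R, c ℓ)) (g := fun ℓ => (ℓ ∈ R', c' ℓ))
      (fun x => (hfib x.1 x.2).some) ℓ
    exact (Prod.ext_iff.1 this).1.to_iff
  · intro ℓ
    have := Equiv.ofFiberEquiv_map (f := fun ℓ => (ℓ ∈ R, c ℓ)) (g := fun ℓ => (ℓ ∈ R', c' ℓ))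
      (fun x => (hfib x.1 x.2).some) ℓ
    exact (Prod.ext_iff.1 this).2

theorem sum_classWeight_mul_charProd_congr {s : ℕ} (cls : X → Fin (s + 1))
    (dcls : AddChar X ℂ → Fin (s + 1))
    (hcls : ∀ ε η : AddChar X ℂ, dcls ε = dcls η →
      ∀ j, ∑ x with cls x = j, ε x = ∑ x with cls x = j, η x)
    (p : MvPolynomial (Fin s) ℝ) {R R' : Finset (Fin n)} (hR : R.card = R'.card)
    (ε η : Fin n → AddChar X ℂ)
    (h : ∀ i : Fin s, (univ.filter fun ℓ => dcls (ε ℓ) = i.succ).card =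
      (univ.filter fun ℓ => dcls (η ℓ) = i.succ).card)
    (hr : ∀ i : Fin s, (R.filter fun ℓ => dcls (ε ℓ) = i.succ).card =
      (R'.filter fun ℓ => dcls (η ℓ) = i.succ).card) :
    ∑ x : Fin n → X, classWeight p R (fun ℓ => cls (x ℓ)) * charProd ε x =
      ∑ x : Fin n → X, classWeight p R' (fun ℓ => cls (x ℓ)) * charProd η x := by
  obtain ⟨σ, hσR, hσ⟩ := exists_perm_of_card_fiber_eq (fun ℓ => dcls (ε ℓ))
    (fun ℓ => dcls (η ℓ)) R R' hR h hr
  rw [sum_comp_mul_charProd_congr cls (classWeight p R) ε (fun ℓ => η (σ ℓ))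
    fun ℓ j => hcls _ _ (hσ ℓ).symm j]
  rw [← (Equiv.arrowCongr σ.symm (Equiv.refl X)).sum_comp]
  refine Finset.sum_congr rfl fun x _ => ?_
  have hx : ∀ ℓ, (Equiv.arrowCongr σ.symm (Equiv.refl X)) x ℓ = x (σ ℓ) := fun ℓ => rfl
  simp only [charProd, hx]
  rw [classWeight_comp_perm p (fun ℓ => cls (x ℓ)) σ hσR,
    Equiv.prod_comp σ fun ℓ => η ℓ (x ℓ)]

end Characters

section Codes

variable {X : Type} {n s : ℕ}

theorem sum_card_class_eq (c : Fin n → Fin (s + 1)) :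
    ∑ i : Fin s, (univ.filter fun ℓ => c ℓ = i.succ).card =
      (univ.filter fun ℓ => c ℓ ≠ 0).card := by
  have h1 := Finset.card_eq_sum_card_fiberwise (s := univ) (t := univ) (f := c) (by simp)
  have h2 := Finset.card_filter_add_card_filter_not (s := univ) (fun ℓ => c ℓ = 0)
  rw [Fin.sum_univ_succ] at h1
  have : (univ.filter fun ℓ => c ℓ ≠ 0).card = (univ.filter fun ℓ => ¬ c ℓ = 0).card := rfl
  omega

/-- Independence of the weighted code sum from the position of the coordinate set `R`. -/
theorem sum_code_classWeight_congr [AddCommGroup X] [Fintype X] (C : AddSubgroup (Fin n → X))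
    (cls : X → Fin (s + 1)) (dcls : AddChar X ℂ → Fin (s + 1))
    (hcls : ∀ ε η : AddChar X ℂ, dcls ε = dcls η →
      ∀ j, ∑ x with cls x = j, ε x = ∑ x with cls x = j, η x)
    (hd0 : ∀ ε, dcls ε = 0 ↔ ε = 1)
    (p : MvPolynomial (Fin s) ℝ) {R R' : Finset (Fin n)} (hR : R.card = R'.card)
    (hbal : ∀ β γ : Fin s → ℕ, β ≠ 0 → ∑ i, β i ≤ p.totalDegree + R.card →
      (univ.filter fun ε : Fin n → AddChar X ℂ => (∀ y ∈ C, charProd ε y = 1) ∧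
        (∀ i : Fin s, (univ.filter fun ℓ => dcls (ε ℓ) = i.succ).card = β i) ∧
        ∀ i : Fin s, (R.filter fun ℓ => dcls (ε ℓ) = i.succ).card = γ i).card =
      (univ.filter fun ε : Fin n → AddChar X ℂ => (∀ y ∈ C, charProd ε y = 1) ∧
        (∀ i : Fin s, (univ.filter fun ℓ => dcls (ε ℓ) = i.succ).card = β i) ∧
        ∀ i : Fin s, (R'.filter fun ℓ => dcls (ε ℓ) = i.succ).card = γ i).card) :
    ∑ x with x ∈ C, classWeight p R (fun ℓ => cls (x ℓ)) =
      ∑ x with x ∈ C, classWeight p R' (fun ℓ => cls (x ℓ)) := by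
  have hX : (Fintype.card X : ℂ) ^ n ≠ 0 := pow_ne_zero _ (by simp)
  refine mul_left_cancel₀ hX ?_
  rw [poisson_summation, poisson_summation]
  congr 1
  set key : Finset (Fin n) → (Fin n → AddChar X ℂ) → (Fin s → ℕ) × (Fin s → ℕ) := fun U ε =>
    (fun i => (univ.filter fun ℓ => dcls (ε ℓ) = i.succ).card,
      fun i => (U.filter fun ℓ => dcls (ε ℓ) = i.succ).card) with hkey
  rw [← Finset.sum_fiberwise_of_maps_to (t := univ.image (key R) ∪ univ.image (key R'))
      (g := key R) (fun ε _ => by simp),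
    ← Finset.sum_fiberwise_of_maps_to (t := univ.image (key R) ∪ univ.image (key R'))
      (g := key R') (fun ε _ => by simp)]
  refine Finset.sum_congr rfl fun βγ _ => ?_
  obtain ⟨β, γ⟩ := βγ
  set E : Finset (Fin n) → Finset (Fin n → AddChar X ℂ) := fun U =>
    univ.filter fun ε : Fin n → AddChar X ℂ => (∀ y ∈ C, charProd ε y = 1) ∧
      (∀ i : Fin s, (univ.filter fun ℓ => dcls (ε ℓ) = i.succ).card = β i) ∧
      ∀ i : Fin s, (U.filter fun ℓ => dcls (ε ℓ) = i.succ).card = γ i with hE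
  have hfil : ∀ U : Finset (Fin n), ((univ.filter fun ε : Fin n → AddChar X ℂ =>
      ∀ y ∈ C, charProd ε y = 1).filter fun ε => key U ε = (β, γ)) = E U := by
    intro U
    rw [Finset.filter_filter]
    simp only [hE, hkey, Prod.mk.injEq, funext_iff]
  rw [hfil, hfil]
  rcases le_or_gt (∑ i, β i) (p.totalDegree + R.card) with hβ | hβ
  · have hcard : (E R).card = (E R').card := by
      by_cases h : β = 0
      · subst h
        congr 1
        ext ε
        simp only [hE, Finset.mem_filter, Finset.mem_univ, true_and, Pi.zero_apply]
        refine and_congr_right fun _ => and_congr_right fun h => forall_congr' fun i => ?_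
        have h0 : ∀ U : Finset (Fin n), (U.filter fun ℓ => dcls (ε ℓ) = i.succ).card = 0 :=
          fun U => Nat.le_zero.1 ((Finset.card_le_card
            (Finset.filter_subset_filter _ (Finset.subset_univ U))).trans (h i).le)
        rw [h0, h0]
      · exact hbal β γ h hβ
    rcases Finset.eq_empty_or_nonempty (E R) with he | ⟨ε₀, hε₀⟩
    · rw [he, Finset.card_empty] at hcard
      rw [he, Finset.card_eq_zero.1 hcard.symm, Finset.sum_empty, Finset.sum_empty]
    · have hε₀ := (Finset.mem_filter.1 hε₀).2
      rw [Finset.sum_congr rfl fun ε hε => ?_, Finset.sum_const, hcard, ← Finset.sum_const]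
      · refine Finset.sum_congr rfl fun ε hε => ?_
        have hε := (Finset.mem_filter.1 hε).2
        exact sum_classWeight_mul_charProd_congr cls dcls hcls p hR ε₀ ε
          (fun i => (hε₀.2.1 i).trans (hε.2.1 i).symm)
          (fun i => (hε₀.2.2 i).trans (hε.2.2 i).symm)
      · have hε := (Finset.mem_filter.1 hε).2
        exact sum_classWeight_mul_charProd_congr cls dcls hcls p rfl ε ε₀
          (fun i => (hε.2.1 i).trans (hε₀.2.1 i).symm)
          (fun i => (hε.2.2 i).trans (hε₀.2.2 i).symm)
  · have hz : ∀ U : Finset (Fin n), U.card = R.card → ∀ ε : Fin n → AddChar X ℂ,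
        (∀ i : Fin s, (univ.filter fun ℓ => dcls (ε ℓ) = i.succ).card = β i) →
        ∑ x : Fin n → X, classWeight p U (fun ℓ => cls (x ℓ)) * charProd ε x = 0 := by
      intro U hU ε hε
      refine sum_classWeight_mul_charProd_eq_zero cls p U ε ?_
      rw [hU]
      refine hβ.trans_le (le_of_eq ?_)
      rw [← Finset.sum_congr rfl fun i _ => hε i, sum_card_class_eq]
      simp only [ne_eq, hd0]
    rw [Finset.sum_eq_zero fun ε hε => hz R rfl ε (Finset.mem_filter.1 hε).2.2.1,
      Finset.sum_eq_zero fun ε hε => hz R' hR.symm ε (Finset.mem_filter.1 hε).2.2.1]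

/-- The number of words in `D` of class composition `α` whose classes on `R` are nonzero. -/
def coverCount [Fintype X] (D : Finset (Fin n → X)) (cls : X → Fin (s + 1)) (α : Fin s → ℕ)
    (R : Finset (Fin n)) : ℕ :=
  (D.filter fun x => (∀ i : Fin s, (univ.filter fun ℓ => cls (x ℓ) = i.succ).card = α i) ∧
    ∀ ℓ ∈ R, cls (x ℓ) ≠ 0).card

variable [Fintype X] (D : Finset (Fin n → X)) (cls : X → Fin (s + 1))

theorem sum_classWeight_eq_sum_coverCount (p : MvPolynomial (Fin s) ℝ) (R : Finset (Fin n))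
    (K : Finset (Fin s → ℕ))
    (hK : ∀ x ∈ D, (fun i : Fin s => (univ.filter fun ℓ => cls (x ℓ) = i.succ).card) ∈ K) :
    ∑ x ∈ D, classWeight p R (fun ℓ => cls (x ℓ)) =
      ∑ β ∈ K, (coverCount D cls β R : ℂ) *
        ((MvPolynomial.eval (fun i => (β i : ℝ)) p : ℝ) : ℂ) := by
  rw [← Finset.sum_fiberwise_of_maps_to hK]
  refine Finset.sum_congr rfl fun β _ => ?_
  rw [coverCount, ← Finset.filter_filter, Finset.natCast_card_filter, Finset.sum_mul]
  refine Finset.sum_congr ?_ fun x hx => ?_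
  · simp only [funext_iff]
  · have hx : ∀ i : Fin s, (univ.filter fun ℓ => cls (x ℓ) = i.succ).card = β i :=
      (Finset.mem_filter.1 hx).2
    simp only [classWeight, hx]
    split_ifs <;> simp

theorem coverCount_eq_zero_of_lt {α : Fin s → ℕ} {R : Finset (Fin n)}
    (h : ∑ i, α i < R.card) : coverCount D cls α R = 0 := by
  rw [coverCount, Finset.card_eq_zero, Finset.filter_eq_empty_iff]
  rintro x - ⟨h1, h2⟩
  rw [← Finset.sum_congr rfl fun i _ => h1 i, sum_card_class_eq] at h
  exact h.not_ge (Finset.card_le_card fun ℓ hℓ => by simpa using h2 ℓ hℓ)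

theorem coverCount_eq_zero_of_forall_ne {α : Fin s → ℕ} (R : Finset (Fin n))
    (h : ∀ x ∈ D, ¬ ∀ i : Fin s, (univ.filter fun ℓ => cls (x ℓ) = i.succ).card = α i) :
    coverCount D cls α R = 0 := by
  rw [coverCount, Finset.card_eq_zero, Finset.filter_eq_empty_iff]
  exact fun x hx h' => h x hx h'.1

/-- Inclusion-exclusion when no word vanishes on the whole of `R`. -/
theorem sum_powerset_coverCount_eq_zero {α : Fin s → ℕ} {R : Finset (Fin n)}
    (h : n < R.card + ∑ i, α i) :
    ∑ Q ∈ R.powerset, (-1 : ℤ) ^ Q.card * (coverCount D cls α Q : ℤ) = 0 := by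
  have hprod : ∀ x : Fin n → X, ∏ ℓ ∈ R, ((1 : ℤ) - if cls (x ℓ) ≠ 0 then 1 else 0) =
      ∑ Q ∈ R.powerset, (-1 : ℤ) ^ Q.card * if ∀ ℓ ∈ Q, cls (x ℓ) ≠ 0 then 1 else 0 := by
    intro x
    rw [Finset.prod_sub]
    refine Finset.sum_congr rfl fun Q _ => ?_
    rw [Finset.prod_const_one, mul_one, Finset.prod_ite_zero]
    simp
  have hcount : ∀ Q : Finset (Fin n), (coverCount D cls α Q : ℤ) =
      ∑ x ∈ D with ∀ i : Fin s, (univ.filter fun ℓ => cls (x ℓ) = i.succ).card = α i,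
        if ∀ ℓ ∈ Q, cls (x ℓ) ≠ 0 then 1 else 0 := by
    intro Q
    rw [coverCount, ← Finset.filter_filter, Finset.natCast_card_filter]
  simp only [hcount, Finset.mul_sum]
  rw [Finset.sum_comm]
  refine Finset.sum_eq_zero fun x hx => ?_
  rw [← hprod, Finset.prod_eq_zero_iff]
  by_contra hne
  push Not at hne
  have hx := (Finset.mem_filter.1 hx).2
  rw [← Finset.sum_congr rfl fun i _ => hx i, sum_card_class_eq] at h
  have hdisj : Disjoint R (univ.filter fun ℓ => cls (x ℓ) ≠ 0) := by
    rw [Finset.disjoint_left]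
    intro ℓ hℓ hℓ'
    exact hne ℓ hℓ (by simp [(Finset.mem_filter.1 hℓ').2])
  have := (Finset.card_union_of_disjoint hdisj).symm.trans_le (Finset.card_le_univ _)
  rw [Fintype.card_fin] at this
  omega

theorem coverCount_congr_of_card_lt {α : Fin s → ℕ} {R R' : Finset (Fin n)}
    (hR : R.card = R'.card) (h : n < R.card + ∑ i, α i)
    (ih : ∀ Q Q' : Finset (Fin n), Q.card < R.card → Q.card = Q'.card →
      coverCount D cls α Q = coverCount D cls α Q') :
    coverCount D cls α R = coverCount D cls α R' := by
  obtain ⟨f, hf⟩ : ∃ f : ℕ → ℤ, ∀ Q : Finset (Fin n), Q.card < R.card →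
      (coverCount D cls α Q : ℤ) = f Q.card := by
    refine ⟨fun q => if h : ∃ Q : Finset (Fin n), Q.card = q then coverCount D cls α h.choose
      else 0, fun Q hQ => ?_⟩
    have hex : ∃ Q' : Finset (Fin n), Q'.card = Q.card := ⟨Q, rfl⟩
    simp only [hex, dif_pos]
    exact_mod_cast ih _ _ hQ hex.choose_spec.symm
  have key : ∀ U : Finset (Fin n), U.card = R.card →
      (-1 : ℤ) ^ R.card * (coverCount D cls α U : ℤ) =
        (-1 : ℤ) ^ R.card * f R.card -
          ∑ m ∈ Finset.range (R.card + 1), (R.card.choose m) • ((-1 : ℤ) ^ m * f m) := by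
    intro U hU
    have h0 := sum_powerset_coverCount_eq_zero D cls (α := α) (R := U) (by rwa [hU])
    have h1 := Finset.sum_powerset_apply_card (fun m => (-1 : ℤ) ^ m * f m) (x := U)
    rw [hU] at h1
    have hmem : U ∈ U.powerset := Finset.mem_powerset_self U
    have heq : ∑ Q ∈ U.powerset.erase U, (-1 : ℤ) ^ Q.card * (coverCount D cls α Q : ℤ) =
        ∑ Q ∈ U.powerset.erase U, (-1 : ℤ) ^ Q.card * f Q.card := by
      refine Finset.sum_congr rfl fun Q hQ => ?_
      have hQ := Finset.mem_erase.1 hQ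
      have hlt : Q.card < U.card :=
        Finset.card_lt_card ((Finset.mem_powerset.1 hQ.2).ssubset_of_ne hQ.1)
      rw [hf Q (hU ▸ hlt)]
    rw [← Finset.add_sum_erase _ _ hmem, hU] at h0 h1
    rw [← h1, ← heq]
    linarith
  have := (key R rfl).trans (key R' hR.symm).symm
  exact_mod_cast mul_left_cancel₀ (pow_ne_zero _ (by norm_num)) this

end Codes

/-- **Supplement to the Assmus–Mattson theorem for additive codes over translation
association schemes.** -/
theorem assmus_mattson_translation {X : Type} [AddCommGroup X] [Fintype X] [DecidableEq X]
    {s : ℕ} (hs : 1 ≤ s)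
    (P : Fin (s + 1) → Set X) (hP0 : P 0 = {0})
    (A : CommAssocScheme X s) (hA : ∀ i, A.R i = {p : X × X | p.2 - p.1 ∈ P i})
    {n : ℕ} (hn : 2 ≤ n)
    (C : AddSubgroup (Fin n → X))
    (hC1 : 1 < Nat.card C) (hC2 : Nat.card C < Fintype.card X ^ n)
    -- the dual class partition `X* = X₀* ⊔ … ⊔ X_s*` of the character group
    (Pd : Fin (s + 1) → Set (AddChar X ℂ))
    (hPd0 : Pd 0 = {1})
    (hPd_nonempty : ∀ i, (Pd i).Nonempty)
    (hPd_disjoint : ∀ i j, i ≠ j → Pd i ∩ Pd j = ∅)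
    (hPd_cover : ∀ ε : AddChar X ℂ, ∃ i, ε ∈ Pd i)
    (hPd_level : ∀ i, ∀ ε ∈ Pd i, ∀ η : AddChar X ℂ, (η ∈ Pd i ↔
      ∀ j, ∑ x ∈ univ.filter (· ∈ P j), η x = ∑ x ∈ univ.filter (· ∈ P j), ε x))
    -- the dual code
    (Cperp : Set (Fin n → AddChar X ℂ))
    (hCperp : Cperp = {ε | ∀ x : Fin n → X, x ∈ C → ∏ ℓ, ε ℓ (x ℓ) = 1})
    (t : ℕ) (ht1 : 1 ≤ t) (htn : t ≤ n)
    -- for every `α ∈ L` with `|α| ≤ n`, `(X*^n)_α ∩ C^⊥` is a weakly `t`-balanced array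
    -- over the dual scheme
    (L : Set (Fin s → ℕ))
    (hL : ∀ α ∈ L, (∑ i, α i) ≤ n →
      ∀ (Λ Λ' : Finset (Fin n)) (γ : Fin s → ℕ),
        (∑ i, γ i) ≤ Λ.card → Λ.card = Λ'.card → Λ.card ≤ t →
        {ε : Fin n → AddChar X ℂ | ε ∈ Cperp ∧
          (∀ i : Fin s, (univ.filter fun ℓ => ε ℓ ∈ Pd i.succ).card = α i) ∧
          (∀ i : Fin s, (Λ.filter fun ℓ => ε ℓ ∈ Pd i.succ).card = γ i)}.ncard =
        {ε : Fin n → AddChar X ℂ | ε ∈ Cperp ∧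
          (∀ i : Fin s, (univ.filter fun ℓ => ε ℓ ∈ Pd i.succ).card = α i) ∧
          (∀ i : Fin s, (Λ'.filter fun ℓ => ε ℓ ∈ Pd i.succ).card = γ i)}.ncard)
    -- `δ_L*` is the minimum of the (nonempty) set of sizes of compositions outside `L`
    -- realized by the dual code
    (W : Set ℕ)
    (hW : W = {m | ∃ α : Fin s → ℕ, α ≠ 0 ∧ α ∉ L ∧ (∑ i, α i) ≤ n ∧ (∑ i, α i) = m ∧
      ∃ ε ∈ Cperp, ∀ i : Fin s, (univ.filter fun ℓ => ε ℓ ∈ Pd i.succ).card = α i})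
    (hWne : W.Nonempty)
    (δL : ℕ) (hδL : δL = sInf W)
    (S : ℕ → Set (Fin s → ℝ))
    (hS : ∀ r, S r = {z | ∃ α : Fin s → ℕ, z = (fun i => (α i : ℝ)) ∧
      r ≤ ∑ i, α i ∧ (∑ i, α i) ≤ n - r ∧
      ∃ x : Fin n → X, x ∈ C ∧ comp A (fun _ => 0) x = α})
    (hyp : ∀ r : ℕ, 1 ≤ r → r ≤ t → (mu (S r) : ℤ) < (δL : ℤ) - (r : ℤ)) :
    ∀ α : Fin s → ℕ, (∑ i, α i) ≤ n →
      ∃ lam : ℕ, ∀ T : Finset (Fin n), T.card = t →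
        {x : Fin n → X | x ∈ C ∧ comp A (fun _ => 0) x = α ∧
          T ⊆ univ.filter fun ℓ => x ℓ ≠ 0}.ncard = lam := by
  choose cls hclsR using fun x : X => A.rel_cover (0, x)
  choose dcls hdclsP using hPd_cover
  have hP : ∀ x j, x ∈ P j ↔ cls x = j := by
    intro x j
    have hj : x ∈ P j ↔ (0, x) ∈ A.R j := by simp [hA]
    rw [hj]
    refine ⟨fun h => ?_, fun h => h ▸ hclsR x⟩
    by_contra hne
    exact Set.eq_empty_iff_forall_notMem.1 (A.rel_disjoint _ _ hne) _ ⟨hclsR x, h⟩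
  have hPd : ∀ ε j, ε ∈ Pd j ↔ dcls ε = j := by
    intro ε j
    refine ⟨fun h => ?_, fun h => h ▸ hdclsP ε⟩
    by_contra hne
    exact Set.eq_empty_iff_forall_notMem.1 (hPd_disjoint _ _ hne) _ ⟨hdclsP ε, h⟩
  have hcls0 : ∀ x, cls x = 0 ↔ x = 0 := fun x => by rw [← hP, hP0, Set.mem_singleton_iff]
  have hd0 : ∀ ε, dcls ε = 0 ↔ ε = 1 := fun ε => by rw [← hPd, hPd0, Set.mem_singleton_iff]
  have hcls : ∀ ε η : AddChar X ℂ, dcls ε = dcls η →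
      ∀ j, ∑ x with cls x = j, ε x = ∑ x with cls x = j, η x := by
    intro ε η h j
    have := (hPd_level (dcls η) η (hdclsP η) ε).1 ((hPd _ _).2 h) j
    simpa only [hP] using this
  have hcomp : ∀ (x : Fin n → X) (β : Fin s → ℕ), comp A (fun _ => 0) x = β ↔
      ∀ i : Fin s, (univ.filter fun ℓ => cls (x ℓ) = i.succ).card = β i := by
    intro x β
    rw [funext_iff]
    simp only [comp, hA, Set.mem_ofPred_eq, sub_zero, hP]
  have hbal : ∀ (R R' : Finset (Fin n)) (d : ℕ), R.card = R'.card → R.card ≤ t → d < δL →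
      ∀ β γ : Fin s → ℕ, β ≠ 0 → ∑ i, β i ≤ d →
      (univ.filter fun ε : Fin n → AddChar X ℂ => (∀ y ∈ C, charProd ε y = 1) ∧
        (∀ i : Fin s, (univ.filter fun ℓ => dcls (ε ℓ) = i.succ).card = β i) ∧
        ∀ i : Fin s, (R.filter fun ℓ => dcls (ε ℓ) = i.succ).card = γ i).card =
      (univ.filter fun ε : Fin n → AddChar X ℂ => (∀ y ∈ C, charProd ε y = 1) ∧
        (∀ i : Fin s, (univ.filter fun ℓ => dcls (ε ℓ) = i.succ).card = β i) ∧
        ∀ i : Fin s, (R'.filter fun ℓ => dcls (ε ℓ) = i.succ).card = γ i).card := by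
    intro R R' d hR hRt hd β γ hβ0 hβd
    by_cases hβn : ∑ i, β i ≤ n ∧ ∑ i, γ i ≤ R.card ∧ β ∈ L
    · have := hL β hβn.2.2 hβn.1 R R' γ hβn.2.1 hR hRt
      simp only [hPd, hCperp, Set.mem_ofPred_eq] at this
      rw [← Set.ncard_coe_finset, ← Set.ncard_coe_finset]
      simp only [Finset.coe_filter, Finset.mem_univ, true_and]
      exact this
    · have hempty : ∀ U : Finset (Fin n), U.card = R.card →
          (univ.filter fun ε : Fin n → AddChar X ℂ => (∀ y ∈ C, charProd ε y = 1) ∧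
            (∀ i : Fin s, (univ.filter fun ℓ => dcls (ε ℓ) = i.succ).card = β i) ∧
            ∀ i : Fin s, (U.filter fun ℓ => dcls (ε ℓ) = i.succ).card = γ i) = ∅ := by
        intro U hU
        rw [Finset.filter_eq_empty_iff]
        rintro ε - ⟨h1, h2, h3⟩
        have hβn' : ∑ i, β i ≤ n := by
          rw [← Finset.sum_congr rfl fun i _ => h2 i, sum_card_class_eq]
          exact (Finset.card_le_univ _).trans (by simp)
        refine hβn ⟨hβn', ?_, ?_⟩
        · rw [← Finset.sum_congr rfl fun i _ => h3 i, ← hU,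
            Finset.card_eq_sum_card_fiberwise (s := U) (t := univ) (f := fun ℓ => dcls (ε ℓ))
              (by simp), Fin.sum_univ_succ]
          exact Nat.le_add_left _ _
        · by_contra hβL
          refine (hβd.trans_lt hd).not_ge (hδL ▸ Nat.sInf_le ?_)
          rw [hW]
          refine ⟨β, hβ0, hβL, hβn', rfl, ε, ?_, ?_⟩
          · rw [hCperp]
            exact h1
          · simpa only [hPd] using h2
      rw [hempty R rfl, hempty R' hR.symm]
  set D : Finset (Fin n → X) := univ.filter fun x => x ∈ C with hD
  have main : ∀ r, r ≤ t → ∀ (α : Fin s → ℕ) (R R' : Finset (Fin n)), R.card = r →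
      R.card = R'.card → coverCount D cls α R = coverCount D cls α R' := by
    intro r
    induction r using Nat.strong_induction_on with
    | _ r ih =>
      intro hrt α R R' hRr hR
      rcases Nat.eq_zero_or_pos r with rfl | hr
      · rw [Finset.card_eq_zero.1 hRr, Finset.card_eq_zero.1 (hR.symm.trans hRr)]
      have hout : ∀ β : Fin s → ℕ, (fun i => (β i : ℝ)) ∉ S r →
          coverCount D cls β R = coverCount D cls β R' := by
        intro β hβ
        by_cases h1 : ∑ i, β i < r
        · rw [coverCount_eq_zero_of_lt D cls (hRr ▸ h1),
            coverCount_eq_zero_of_lt D cls (hR ▸ hRr ▸ h1)]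
        by_cases h2 : n < r + ∑ i, β i
        · refine coverCount_congr_of_card_lt D cls hR (hRr ▸ h2) fun Q Q' hQ hQQ' => ?_
          exact ih Q.card (hRr ▸ hQ) ((hQ.trans_eq hRr).le.trans hrt) β Q Q' rfl hQQ'
        have hno : ∀ x ∈ D, ¬ ∀ i : Fin s,
            (univ.filter fun ℓ => cls (x ℓ) = i.succ).card = β i := by
          intro x hx hxβ
          refine hβ ?_
          rw [hS]
          exact ⟨β, rfl, by omega, by omega, x, (Finset.mem_filter.1 hx).2, (hcomp x β).2 hxβ⟩
        rw [coverCount_eq_zero_of_forall_ne D cls R hno,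
          coverCount_eq_zero_of_forall_ne D cls R' hno]
      by_cases hαS : (fun i => (α i : ℝ)) ∈ S r
      swap
      · exact hout α hαS
      have hSfin : (S r).Finite := by
        refine (Set.finite_range fun x : Fin n → X =>
          fun i => (comp A (fun _ => 0) x i : ℝ)).subset ?_
        rw [hS]
        rintro _ ⟨β, rfl, -, -, x, -, rfl⟩
        exact ⟨x, rfl⟩
      obtain ⟨q, hq⟩ := exists_eval_eq_ite hSfin.toFinset fun i => (α i : ℝ)
      obtain ⟨p, hpdeg, hp⟩ := exists_totalDegree_le_mu hSfin q
      have hpS : ∀ z ∈ S r, MvPolynomial.eval z p = if z = fun i => (α i : ℝ) then 1 else 0 :=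
        fun z hz => (hp z hz).trans (hq z (hSfin.mem_toFinset.2 hz))
      have hδ : p.totalDegree + R.card < δL := by
        have := hyp r hr hrt
        omega
      have hsum := sum_code_classWeight_congr C cls dcls hcls hd0 p hR
        (hbal R R' _ hR (hRr.trans_le hrt) hδ)
      set K : Finset (Fin s → ℕ) := insert α (D.image fun (x : Fin n → X) i =>
        (univ.filter fun ℓ => cls (x ℓ) = i.succ).card) with hK
      have hDK : ∀ x ∈ D,
          (fun i : Fin s => (univ.filter fun ℓ => cls (x ℓ) = i.succ).card) ∈ K :=
        fun x hx => Finset.mem_insert_of_mem (Finset.mem_image_of_mem _ hx)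
      rw [← hD, sum_classWeight_eq_sum_coverCount D cls p R K hDK,
        sum_classWeight_eq_sum_coverCount D cls p R' K hDK, ← sub_eq_zero,
        ← Finset.sum_sub_distrib, Finset.sum_eq_single α] at hsum
      · rw [hpS _ hαS, if_pos rfl] at hsum
        simpa [sub_eq_zero] using hsum
      · intro β _ hβα
        by_cases hβS : (fun i => (β i : ℝ)) ∈ S r
        · rw [hpS _ hβS, if_neg]
          · simp
          · intro h
            exact hβα (funext fun i => by exact_mod_cast congrFun h i)
        · rw [hout β hβS, sub_self]
      · exact fun h => absurd (Finset.mem_insert_self _ _) h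
  intro α _
  obtain ⟨T₀, -, hT₀⟩ := Finset.exists_subset_card_eq
    (show t ≤ (univ : Finset (Fin n)).card by simpa using htn)
  refine ⟨coverCount D cls α T₀, fun T hT => ?_⟩
  rw [← main t le_rfl α T T₀ hT (hT.trans hT₀.symm), coverCount, ← Set.ncard_coe_finset]
  congr 1
  ext x
  simp only [hcomp, hD, Finset.coe_filter, Finset.mem_filter, Finset.mem_univ, true_and,
    Set.mem_ofPred_eq, Finset.subset_iff, ne_eq, hcls0]
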